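/- Doubly robust personalized pricing estimators (linear demand). Let (Ω, ℱ, P) be a probability space, Z a measurable space, and z : Ω → Z, p : Ω → ℝ (price), d : Ω → ℝ (demand) measurable, with all displayed conditional expectations well defined. Let 𝔪 and 𝔤 denote the σ-algebras generated by z and by (p, z) respectively. Suppose E[d ∣ 𝔤] = a ∘ z + (b ∘ z)·p almost surely for measurable a, b : Z → ℝ, and that the logging policy is homoskedastic: E[p ∣ 𝔪] = g ∘ z and E[p² ∣ 𝔪] = σ² + (g ∘ z)² almost surely, for measurable g : Z → ℝ and a constant σ² > 0. For any measurable â, b̂ : Z → ℝ define the doubly robust estimates a_DR := â(z) + (1 + g(z)·(g(z) − p)/σ²)·(d − â(z) − b̂(z)·p) and b_DR := b̂(z) + ((p − g(z))/σ²)·(d − â(z) − b̂(z)·p). Then E[a_DR ∣ 𝔪] = a ∘ z and E[b_DR ∣ 𝔪] = b ∘ z almost surely. -/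

import Mathlib

open MeasureTheory

/-- Pulling out known factors from a finite sum: if `F = ∑ i, c i * f i` with `F` and all `f i`
integrable and all `c i` measurable with respect to `m`, then `μ[F | m] = ∑ i, c i * μ[f i | m]`
almost surely. The individual products `c i * f i` need not be integrable. -/
theorem condExp_sum_mul_of_integrable {Ω ι : Type*} [Fintype ι] {m m0 : MeasurableSpace Ω}
    {μ : Measure Ω} [IsFiniteMeasure μ] (hm : m ≤ m0) {F : Ω → ℝ} {c f : ι → Ω → ℝ}
    (hc : ∀ i, Measurable[m] (c i)) (hf : ∀ i, Integrable (f i) μ) (hF : Integrable F μ)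
    (hFc : ∀ ω, F ω = ∑ i, c i ω * f i ω) :
    μ[F | m] =ᵐ[μ] fun ω => ∑ i, c i ω * (μ[f i | m]) ω := by
  let s : ℕ → Set Ω := fun n => ⋂ i, {ω | |c i ω| ≤ n}
  have hs (n : ℕ) : MeasurableSet[m] (s n) :=
    MeasurableSet.iInter fun i =>
      measurableSet_le (measurable_norm.comp (hc i)) measurable_const
  have key (n : ℕ) : ∀ᵐ ω ∂μ, ω ∈ s n → (μ[F | m]) ω = ∑ i, c i ω * (μ[f i | m]) ω := by
    have hcs (i : ι) : StronglyMeasurable[m] ((s n).indicator (c i)) :=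
      ((hc i).indicator (hs n)).stronglyMeasurable
    have hbound (i : ι) (ω : Ω) : ‖(s n).indicator (c i) ω‖ ≤ n := by
      by_cases hω : ω ∈ s n
      · simpa [hω] using Set.mem_iInter.1 hω i
      · simp [hω]
    have hint (i : ι) : Integrable ((s n).indicator (c i) * f i) μ :=
      (hf i).bdd_mul ((hcs i).mono hm).aestronglyMeasurable
        (Filter.Eventually.of_forall (hbound i))
    have hsum : (s n).indicator F = ∑ i, (s n).indicator (c i) * f i := by
      ext ω
      by_cases hω : ω ∈ s n <;> simp [hω, hFc]
    have hpull : ∀ᵐ ω ∂μ, ∀ i, (μ[(s n).indicator (c i) * f i | m]) ω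
        = (s n).indicator (c i) ω * (μ[f i | m]) ω :=
      ae_all_iff.2 fun i => condExp_mul_of_stronglyMeasurable_left (hcs i) (hint i) (hf i)
    filter_upwards [condExp_indicator hF (hs n), condExp_finsetSum (s := Finset.univ)
      (fun i _ => hint i) m, hpull] with ω h1 h2 h3 hω
    rw [hsum, h2] at h1
    simpa [hω, h3] using h1.symm
  filter_upwards [ae_all_iff.2 key] with ω hω
  obtain ⟨n, hn⟩ := exists_nat_ge (∑ i, |c i ω|)
  exact hω n (Set.mem_iInter.2 fun i =>
    (Finset.single_le_sum (f := fun j => |c j ω|) (fun j _ => abs_nonneg _)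
      (Finset.mem_univ i)).trans hn)

/-- If `μ[d | σ(p, z)] = a(z) + b(z) p` and `p` has conditional mean `g(z)` and conditional second
moment `v(z)` given `z`, then the residual `e = d - â(z) - b̂(z) p` and the product `p e` have
conditional expectations given `z` expressed through the nuisance errors `a - â`, `b - b̂`. -/
theorem condExp_linear_residual {Ω Z : Type*} [MeasurableSpace Ω] [MeasurableSpace Z]
    {μ : Measure Ω} [IsFiniteMeasure μ] {z : Ω → Z} {pr d : Ω → ℝ}
    (hz : Measurable z) (hpr : Measurable pr)
    {a b g v ah bh : Z → ℝ} (ham : Measurable a) (hbm : Measurable b)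
    (hahm : Measurable ah) (hbhm : Measurable bh)
    (hdemand : μ[d | MeasurableSpace.comap (fun ω => (pr ω, z ω)) inferInstance]
      =ᵐ[μ] fun ω => a (z ω) + b (z ω) * pr ω)
    (hmean : μ[pr | MeasurableSpace.comap z inferInstance] =ᵐ[μ] fun ω => g (z ω))
    (hsec : μ[fun ω => pr ω ^ 2 | MeasurableSpace.comap z inferInstance]
      =ᵐ[μ] fun ω => v (z ω))
    (hintd : Integrable d μ) (hintp : Integrable pr μ)
    (hintp2 : Integrable (fun ω => pr ω ^ 2) μ)
    (hinte : Integrable (fun ω => d ω - ah (z ω) - bh (z ω) * pr ω) μ)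
    (hintpe : Integrable (fun ω => pr ω * (d ω - ah (z ω) - bh (z ω) * pr ω)) μ) :
    (μ[fun ω => d ω - ah (z ω) - bh (z ω) * pr ω | MeasurableSpace.comap z inferInstance]
      =ᵐ[μ] fun ω => (a (z ω) - ah (z ω)) + (b (z ω) - bh (z ω)) * g (z ω)) ∧
    (μ[fun ω => pr ω * (d ω - ah (z ω) - bh (z ω) * pr ω) |
        MeasurableSpace.comap z inferInstance]
      =ᵐ[μ] fun ω => (a (z ω) - ah (z ω)) * g (z ω) + (b (z ω) - bh (z ω)) * v (z ω)) := by
  set e : Ω → ℝ := fun ω => d ω - ah (z ω) - bh (z ω) * pr ω with he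
  set m : MeasurableSpace Ω := MeasurableSpace.comap z inferInstance
  set G : MeasurableSpace Ω :=
    MeasurableSpace.comap (fun ω => (pr ω, z ω)) inferInstance
  have hm : m ≤ _ := hz.comap_le
  have hG : G ≤ _ := (hpr.prodMk hz).comap_le
  have hpair : Measurable[G] (fun ω => (pr ω, z ω)) := comap_measurable _
  have hprG : Measurable[G] pr := measurable_fst.comp hpair
  have hzG : Measurable[G] z := measurable_snd.comp hpair
  have hzm : Measurable[m] z := comap_measurable _
  have hmG : m ≤ G := hzG.comap_le
  have heG : μ[e | G] =ᵐ[μ] fun ω =>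
      (a (z ω) - ah (z ω)) + (b (z ω) - bh (z ω)) * pr ω := by
    have h := condExp_sum_mul_of_integrable (μ := μ) hG (F := e)
      (c := ![fun _ => 1, fun ω => -(ah (z ω) + bh (z ω) * pr ω)]) (f := ![d, fun _ => 1])
      (by
        have h1 : Measurable[G] fun ω => -(ah (z ω) + bh (z ω) * pr ω) :=
          ((hahm.comp hzG).add ((hbhm.comp hzG).mul hprG)).neg
        simpa [Fin.forall_fin_two] using h1)
      (by simpa [Fin.forall_fin_two] using hintd) hinte
      (by intro ω; simp [he]; ring)
    filter_upwards [h, hdemand] with ω h1 h2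
    rw [h1]
    simp [Fin.sum_univ_two, h2, condExp_const hG]
    ring
  have hpeG : μ[fun ω => pr ω * e ω | G] =ᵐ[μ] fun ω =>
      (a (z ω) - ah (z ω)) * pr ω + (b (z ω) - bh (z ω)) * pr ω ^ 2 := by
    filter_upwards [condExp_mul_of_stronglyMeasurable_left (μ := μ) hprG.stronglyMeasurable
      hintpe hinte, heG] with ω h1 h2
    have h3 : (μ[fun ω => pr ω * e ω | G]) ω = pr ω * (μ[e | G]) ω := h1
    rw [h3, h2]
    ring
  have hα : Measurable[m] fun ω => a (z ω) - ah (z ω) := (ham.sub hahm).comp hzm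
  have hβ : Measurable[m] fun ω => b (z ω) - bh (z ω) := (hbm.sub hbhm).comp hzm
  constructor
  · have h := condExp_sum_mul_of_integrable (μ := μ) hm
      (c := ![fun ω => a (z ω) - ah (z ω), fun ω => b (z ω) - bh (z ω)])
      (f := ![fun _ => 1, pr])
      (by simpa [Fin.forall_fin_two] using And.intro hα hβ)
      (by simpa [Fin.forall_fin_two] using hintp) (integrable_condExp.congr heG)
      (by intro ω; simp)
    filter_upwards [condExp_condExp_of_le (μ := μ) (f := e) hmG hG,
      condExp_congr_ae (m := m) heG, h, hmean] with ω h1 h2 h3 h4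
    rw [← h1, h2, h3]
    simp [h4, condExp_const hm]
  · have h := condExp_sum_mul_of_integrable (μ := μ) hm
      (c := ![fun ω => a (z ω) - ah (z ω), fun ω => b (z ω) - bh (z ω)])
      (f := ![pr, fun ω => pr ω ^ 2])
      (by simpa [Fin.forall_fin_two] using And.intro hα hβ)
      (by simpa [Fin.forall_fin_two] using And.intro hintp hintp2)
      (integrable_condExp.congr hpeG)
      (by intro ω; simp)
    filter_upwards [condExp_condExp_of_le (μ := μ) (f := fun ω => pr ω * e ω) hmG hG,
      condExp_congr_ae (m := m) hpeG, h, hmean, hsec] with ω h1 h2 h3 h4 h5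
    rw [← h1, h2, h3]
    simp [h4, h5]

/-- Doubly robust personalized pricing estimators (linear demand):
under `E[d ∣ σ(p,z)] = a(z) + b(z)p`, `E[p ∣ σ(z)] = g(z)`, `E[p² ∣ σ(z)] = σ² + g(z)²`,
the doubly robust estimates satisfy `E[a_DR ∣ σ(z)] = a(z)` and `E[b_DR ∣ σ(z)] = b(z)`
almost surely, for any measurable nuisances `â, b̂`. -/
theorem pricing_linear_doubly_robust
    {Ω Z : Type*} [MeasurableSpace Ω] [MeasurableSpace Z]
    (μ : Measure Ω) [IsProbabilityMeasure μ]
    (z : Ω → Z) (pr d : Ω → ℝ)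
    (hz : Measurable z) (hpr : Measurable pr) (hd : Measurable d)
    (a b g : Z → ℝ) (ham : Measurable a) (hbm : Measurable b) (hgm : Measurable g)
    (σ2 : ℝ) (hσ2 : 0 < σ2)
    -- linear demand model
    (hdemand : μ[d | MeasurableSpace.comap (fun ω => (pr ω, z ω)) inferInstance]
        =ᵐ[μ] fun ω => a (z ω) + b (z ω) * pr ω)
    -- homoskedastic logging policy
    (hmean : μ[pr | MeasurableSpace.comap z inferInstance] =ᵐ[μ] fun ω => g (z ω))
    (hsec : μ[fun ω => pr ω ^ 2 | MeasurableSpace.comap z inferInstance]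
        =ᵐ[μ] fun ω => σ2 + g (z ω) ^ 2)
    -- nuisance estimates
    (ah bh : Z → ℝ) (hahm : Measurable ah) (hbhm : Measurable bh)
    -- all displayed conditional expectations are well defined
    (hintd : Integrable d μ) (hintp : Integrable pr μ)
    (hintp2 : Integrable (fun ω => pr ω ^ 2) μ)
    (hinte : Integrable (fun ω => d ω - ah (z ω) - bh (z ω) * pr ω) μ)
    (hintpe : Integrable (fun ω => pr ω * (d ω - ah (z ω) - bh (z ω) * pr ω)) μ)
    (hintaDR : Integrable (fun ω => ah (z ω)
      + (1 + g (z ω) * (g (z ω) - pr ω) / σ2)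
        * (d ω - ah (z ω) - bh (z ω) * pr ω)) μ)
    (hintbDR : Integrable (fun ω => bh (z ω)
      + ((pr ω - g (z ω)) / σ2) * (d ω - ah (z ω) - bh (z ω) * pr ω)) μ) :
    (μ[fun ω => ah (z ω)
        + (1 + g (z ω) * (g (z ω) - pr ω) / σ2)
          * (d ω - ah (z ω) - bh (z ω) * pr ω) |
      MeasurableSpace.comap z inferInstance] =ᵐ[μ] fun ω => a (z ω)) ∧
    (μ[fun ω => bh (z ω)
        + ((pr ω - g (z ω)) / σ2) * (d ω - ah (z ω) - bh (z ω) * pr ω) |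
      MeasurableSpace.comap z inferInstance] =ᵐ[μ] fun ω => b (z ω)) := by
  obtain ⟨hE, hPE⟩ := condExp_linear_residual (v := fun x => σ2 + g x ^ 2) hz hpr ham hbm hahm
    hbhm hdemand hmean hsec hintd hintp hintp2 hinte hintpe
  have hm := hz.comap_le
  have hzm : Measurable[MeasurableSpace.comap z inferInstance] z := comap_measurable _
  have hf : ∀ i, Integrable ((![fun _ => 1, fun ω => d ω - ah (z ω) - bh (z ω) * pr ω,
      fun ω => pr ω * (d ω - ah (z ω) - bh (z ω) * pr ω)] : Fin 3 → Ω → ℝ) i) μ := by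
    simpa [Fin.forall_fin_succ] using And.intro hinte hintpe
  constructor
  · have h := condExp_sum_mul_of_integrable hm
      (c := ![fun ω => ah (z ω), fun ω => 1 + g (z ω) ^ 2 / σ2, fun ω => -(g (z ω) / σ2)])
      (by
        have h0 := hahm.comp hzm
        have h1 := (((hgm.pow_const 2).div_const σ2).const_add 1).comp hzm
        have h2 := (hgm.div_const σ2).neg.comp hzm
        intro i
        fin_cases i
        exacts [h0, h1, h2])
      hf hintaDR (by intro ω; simp [Fin.sum_univ_three]; ring)
    filter_upwards [h, hE, hPE] with ω h1 h2 h3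
    rw [h1]
    simp [Fin.sum_univ_three, h2, h3, condExp_const hm]
    field_simp
    ring
  · have h := condExp_sum_mul_of_integrable hm
      (c := ![fun ω => bh (z ω), fun ω => -(g (z ω) / σ2), fun _ => 1 / σ2])
      (by
        have h0 := hbhm.comp hzm
        have h1 := (hgm.div_const σ2).neg.comp hzm
        intro i
        fin_cases i
        exacts [h0, h1, measurable_const])
      hf hintbDR (by intro ω; simp [Fin.sum_univ_three]; ring)
    filter_upwards [h, hE, hPE] with ω h1 h2 h3
    rw [h1]
    simp [Fin.sum_univ_three, h2, h3, condExp_const hm]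
    field_simp
    ring
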